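/- If G*_S admits a proper 2^{k*}-coloring, then it admits a good 2^{k*}-coloring. That is, for the multiplicity-interval graph G*_S arising from streams with power-of-two periods, the existence of an (unrestricted) proper p_S-coloring implies the existence of a proper coloring respecting the window constraints C(v_s^i) ∈ [(i−1)p_s+1, i·p_s]. -/

import Mathlib

/-- A "good" partial coloring for the multiplicity interval graph `G*_S`:
streams `s` have intervals `[a s, b s - 1]` and periods `2 ^ k s`; with hyperperiod `2 ^ K`
each stream has `2 ^ (K - k s)` copies indexed by `i < 2 ^ (K - k s)`.  `Q` restricts to a
subset of the streams.  The coloring must be proper (copies with intersecting intervals get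
distinct colors) and each copy `i` must receive a color in the window
`[i * 2 ^ k s + 1, (i + 1) * 2 ^ k s]`. -/
def GoodOn {S : Type} (a b k : S → ℕ) (K : ℕ) (Q : S → Prop) (C : S → ℕ → ℕ) : Prop :=
  (∀ s i s' i', Q s → Q s' → i < 2 ^ (K - k s) → i' < 2 ^ (K - k s') →
      (s ≠ s' ∨ i ≠ i') →
      (Finset.Icc (a s) (b s - 1) ∩ Finset.Icc (a s') (b s' - 1)).Nonempty →
      C s i ≠ C s' i')
  ∧ ∀ s, Q s → ∀ i, i < 2 ^ (K - k s) →
      i * 2 ^ k s + 1 ≤ C s i ∧ C s i ≤ (i + 1) * 2 ^ k s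


/-- Intervals have discrepancy at most one. -/
theorem interval_disc {S : Type} [DecidableEq S] : ∀ (n : ℕ) (T : Finset S), T.card = n →
    ∀ (a b : S → ℕ), (∀ s ∈ T, a s ≤ b s) →
    ∃ e : S → ℤ, (∀ s, e s = 1 ∨ e s = -1) ∧
      ∀ l : ℕ, |∑ s ∈ T, (if a s ≤ l ∧ l < b s then e s else 0)| ≤ 1 := by
  intro n
  induction n with
  | zero =>
    intro T hT a b _
    rw [Finset.card_eq_zero] at hT
    subst hT
    exact ⟨fun _ => 1, fun _ => Or.inl rfl, fun l => by simp⟩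
  | succ n ih =>
    intro T hT a b hab
    have hne : T.Nonempty := by
      rw [← Finset.card_pos]; omega
    obtain ⟨s1, hs1, hmin1⟩ := Finset.exists_min_image T a hne
    have hcard : (T.erase s1).card = n := by
      rw [Finset.card_erase_of_mem hs1]; omega
    by_cases hne2 : (T.erase s1).Nonempty
    swap
    · rw [Finset.not_nonempty_iff_eq_empty] at hne2
      refine ⟨fun _ => 1, fun _ => Or.inl rfl, fun l => ?_⟩
      rw [← Finset.add_sum_erase T _ hs1, hne2]
      simp only [Finset.sum_empty, add_zero]
      split_ifs <;> simp
    obtain ⟨s2, hs2, hmin2⟩ := Finset.exists_min_image (T.erase s1) a hne2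
    have h12 : s2 ≠ s1 := Finset.ne_of_mem_erase hs2
    have hs2T : s2 ∈ T := Finset.mem_of_mem_erase hs2
    have ha12 : a s1 ≤ a s2 := hmin1 s2 hs2T
    have hab1 := hab s1 hs1
    have hab2 := hab s2 hs2T
    have hab' : ∀ s ∈ T.erase s1, a s ≤ b s := fun s hs => hab s (Finset.mem_of_mem_erase hs)
    by_cases hc : b s1 ≤ a s2
    · obtain ⟨e, he, hl⟩ := ih (T.erase s1) hcard a b hab'
      refine ⟨e, he, fun l => ?_⟩
      rw [← Finset.add_sum_erase T _ hs1]
      by_cases h : a s1 ≤ l ∧ l < b s1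
      · rw [if_pos h, Finset.sum_eq_zero]
        · rcases he s1 with h | h <;> simp [h]
        · intro s hs
          have := hmin2 s hs
          rw [if_neg]
          omega
      · rw [if_neg h, zero_add]
        exact hl l
    · push Not at hc
      obtain ⟨e, he, hl⟩ := ih (T.erase s1) hcard (Function.update a s2 (min (b s1) (b s2)))
        (Function.update b s2 (max (b s1) (b s2))) (by
          intro s hs
          by_cases h : s = s2
          · subst h; simp
          · simpa [Function.update_of_ne h] using hab' s hs)
      have key : ∀ (e' : S → ℤ) (l : ℕ), (∀ s, s ≠ s1 → s ≠ s2 → e' s = e s) →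
          ∑ s ∈ (T.erase s1).erase s2, (if a s ≤ l ∧ l < b s then e' s else 0) =
          ∑ s ∈ (T.erase s1).erase s2, (if Function.update a s2 (min (b s1) (b s2)) s ≤ l ∧
            l < Function.update b s2 (max (b s1) (b s2)) s then e s else 0) := by
        intro e' l hh
        refine Finset.sum_congr rfl fun s hs => ?_
        have h2 : s ≠ s2 := Finset.ne_of_mem_erase hs
        have h1 : s ≠ s1 := Finset.ne_of_mem_erase (Finset.mem_of_mem_erase hs)
        rw [Function.update_of_ne h2, Function.update_of_ne h2, hh s h1 h2]
      have small : ∀ (e' : S → ℤ) (l : ℕ), l < a s2 →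
          ∑ s ∈ (T.erase s1).erase s2, (if a s ≤ l ∧ l < b s then e' s else 0) = 0 := by
        intro e' l hh
        refine Finset.sum_eq_zero fun s hs => ?_
        have := hmin2 s (Finset.mem_of_mem_erase hs)
        rw [if_neg]
        omega
      let x : ℤ := if b s1 ≤ b s2 then - e s2 else e s2
      let y : ℤ := if b s1 ≤ b s2 then e s2 else - e s2
      let e' : S → ℤ := fun s => if s = s1 then x else if s = s2 then y else e s
      have e1 : e' s1 = x := by simp [e']
      have e2 : e' s2 = y := by simp [e', h12]
      have e3 : ∀ s, s ≠ s1 → s ≠ s2 → e' s = e s := by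
        intro s h h'; simp [e', h, h']
      have hx : x = 1 ∨ x = -1 := by
        have := he s2
        simp only [x]; split_ifs <;> omega
      have hy : y = 1 ∨ y = -1 := by
        have := he s2
        simp only [y]; split_ifs <;> omega
      refine ⟨e', ?_, ?_⟩
      · intro s
        by_cases h : s = s1
        · rw [h, e1]; exact hx
        · by_cases h' : s = s2
          · rw [h', e2]; exact hy
          · rw [e3 s h h']; exact he s
      · intro l
        rw [← Finset.add_sum_erase T _ hs1, ← Finset.add_sum_erase (T.erase s1) _ hs2, e1, e2]
        by_cases hlt : l < a s2
        · rw [small e' l hlt, if_neg (by omega : ¬ (a s2 ≤ l ∧ l < b s2))]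
          split_ifs <;> rcases hx with h | h <;> simp [h]
        · have := hl l
          rw [← Finset.add_sum_erase (T.erase s1) _ hs2, ← key e' l e3] at this
          simp only [Function.update_self] at this
          convert this using 2
          rw [← add_assoc]
          congr 1
          simp only [x, y]
          split_ifs <;> omega

theorem good_main {S : Type} [DecidableEq S] (a b : S → ℕ) (hab : ∀ s, 1 ≤ a s ∧ a s < b s) :
    ∀ (K : ℕ) (T : Finset S) (k : S → ℕ), (∀ s ∈ T, k s ≤ K) →
    (∀ l : ℕ, ∑ s ∈ T, (if a s ≤ l ∧ l < b s then 2 ^ (K - k s) else 0) ≤ 2 ^ K) →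
    ∃ C : S → ℕ → ℕ, GoodOn a b k K (fun s => s ∈ T) C := by
  intro K
  induction K with
  | zero =>
    intro T k hk hload
    refine ⟨fun _ _ => 1, ?_, ?_⟩
    · intro s i s' i' hs hs' hi hi' hne ⟨l, hl⟩
      simp only [Finset.mem_inter, Finset.mem_Icc] at hl
      simp only [Nat.zero_sub, pow_zero] at hi hi'
      have hss : s ≠ s' := by
        rcases hne with h | h
        · exact h
        · omega
      exfalso
      have h1 := hab s
      have h2 := hab s'
      have := hload l
      rw [← Finset.add_sum_erase T _ hs, ← Finset.add_sum_erase (T.erase s) _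
        (Finset.mem_erase.2 ⟨hss.symm, hs'⟩), if_pos (by omega), if_pos (by omega)] at this
      simp only [Nat.zero_sub, pow_zero] at this
      omega
    · intro s hs i hi
      have := hk s hs
      have h0 : k s = 0 := by omega
      simp only [Nat.zero_sub, pow_zero] at hi
      have : i = 0 := by omega
      simp [h0, this]
  | succ K ih =>
    intro T k hk hload
    obtain ⟨e, he, hl⟩ := interval_disc _ (T.filter (fun s => k s = K + 1)) rfl a b
      (fun s _ => (hab s).2.le)
    let k' : S → ℕ := fun s => min (k s) K
    have half : ∀ c : ℤ, (c = 1 ∨ c = -1) →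
        ∃ C : S → ℕ → ℕ, GoodOn a b k' K
          (fun s => s ∈ T.filter (fun s => k s = K + 1 → e s = c)) C := by
      intro c hcc
      refine ih _ k' (fun s _ => min_le_right _ _) ?_
      intro l
      have h1 := hload l
      have h2 := hl l
      rw [Finset.sum_filter] at h2 ⊢
      -- the three loads
      let A : ℕ := ∑ s ∈ T, (if k s = K + 1 then 0 else
        if a s ≤ l ∧ l < b s then 2 ^ (K - k s) else 0)
      let P : ℕ := ∑ s ∈ T, (if k s = K + 1 ∧ e s = c then
        (if a s ≤ l ∧ l < b s then 1 else 0) else 0)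
      let M : ℕ := ∑ s ∈ T, (if k s = K + 1 ∧ e s ≠ c then
        (if a s ≤ l ∧ l < b s then 1 else 0) else 0)
      have g1 : ∑ s ∈ T, (if a s ≤ l ∧ l < b s then 2 ^ (K + 1 - k s) else 0)
          = 2 * A + P + M := by
        simp only [A, P, M]
        rw [Finset.mul_sum, ← Finset.sum_add_distrib, ← Finset.sum_add_distrib]
        refine Finset.sum_congr rfl fun s hs => ?_
        have := hk s hs
        by_cases hks : k s = K + 1
        · by_cases hec : e s = c <;> simp [hks, hec]
        · have : K + 1 - k s = (K - k s) + 1 := by omega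
          simp only [hks, this, pow_succ, false_and, if_false]
          split_ifs <;> ring
      have g2 : (∑ s ∈ T, (if (k s = K + 1 → e s = c) then
          (if a s ≤ l ∧ l < b s then 2 ^ (K - k' s) else 0) else 0)) = A + P := by
        simp only [A, P]
        rw [← Finset.sum_add_distrib]
        refine Finset.sum_congr rfl fun s hs => ?_
        have := hk s hs
        by_cases hks : k s = K + 1
        · by_cases hec : e s = c <;> simp [hks, hec, k']
        · have : k' s = k s := by simp only [k']; omega
          simp [hks, this]
      have g3 : (∑ s ∈ T, (if k s = K + 1 then (if a s ≤ l ∧ l < b s then e s else 0) else 0))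
          = c * ((P : ℤ) - M) := by
        simp only [P, M]
        push_cast
        rw [← Finset.sum_sub_distrib, Finset.mul_sum]
        refine Finset.sum_congr rfl fun s hs => ?_
        by_cases hks : k s = K + 1
        · by_cases hec : e s = c
          · simp [hks, hec]
          · have : e s = -c := by
              have := he s
              omega
            have h3 : -c ≠ c := by omega
            simp [hks, this, h3]
            split_ifs <;> simp
        · simp [hks]
      rw [g1, pow_succ] at h1
      rw [g3] at h2
      rw [g2]
      have h3 : |(P : ℤ) - M| ≤ 1 := by
        rcases hcc with h | h
        · simpa [h] using h2
        · rw [h, abs_mul] at h2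
          simpa using h2
      rw [abs_le] at h3
      omega
    obtain ⟨C0, p0, w0⟩ := half 1 (Or.inl rfl)
    obtain ⟨C1, p1, w1⟩ := half (-1) (Or.inr rfl)
    simp only [Finset.mem_filter] at p0 w0 p1 w1
    have wtop : ∀ s i, i < 2 ^ (K - k' s) → (i + 1) * 2 ^ k' s ≤ 2 ^ K := by
      intro s i hi
      have : k' s ≤ K := min_le_right _ _
      calc (i + 1) * 2 ^ k' s ≤ 2 ^ (K - k' s) * 2 ^ k' s := Nat.mul_le_mul_right _ hi
        _ = 2 ^ K := by rw [← pow_add]; congr 1; omega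
    -- low half indicator and index in the half
    let low : S → ℕ → Prop := fun s i => if k s = K + 1 then e s = 1 else i < 2 ^ (K - k s)
    let idx : S → ℕ → ℕ := fun s i => if i < 2 ^ (K - k s) then i else i - 2 ^ (K - k s)
    classical
    let C : S → ℕ → ℕ := fun s i => if low s i then C0 s (idx s i) else C1 s (idx s i) + 2 ^ K
    have hidx : ∀ s ∈ T, ∀ i, i < 2 ^ (K + 1 - k s) → idx s i < 2 ^ (K - k' s) := by
      intro s hs i hi
      have h1 := hk s hs
      by_cases hks : k s = K + 1
      · have : i = 0 := by simpa [hks] using hi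
        simp [idx, this]
      · have h2 : k' s = k s := by simp only [k']; omega
        have h3 : K + 1 - k s = (K - k s) + 1 := by omega
        rw [h3, pow_succ] at hi
        rw [h2]
        simp only [idx]
        split_ifs <;> omega
    have hlow : ∀ s i, low s i → (k s = K + 1 → e s = 1) := by
      intro s i h hks
      simpa [low, hks] using h
    have hhigh : ∀ s i, ¬ low s i → (k s = K + 1 → e s = -1) := by
      intro s i h hks
      have := he s
      simp only [low, hks, if_true] at h
      omega
    have hinj : ∀ s ∈ T, ∀ i i', i < 2 ^ (K + 1 - k s) → i' < 2 ^ (K + 1 - k s) →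
        (low s i ↔ low s i') → i ≠ i' → idx s i ≠ idx s i' := by
      intro s hs i i' hi hi' hll hne
      have h1 := hk s hs
      by_cases hks : k s = K + 1
      · simp [hks] at hi hi'
        omega
      · simp only [low, hks, if_false] at hll
        simp only [idx]
        split_ifs <;> omega
    refine ⟨C, ?_, ?_⟩
    · intro s i s' i' hs hs' hi hi' hne hint
      have hj := hidx s hs i hi
      have hj' := hidx s' hs' i' hi'
      have hne' : (low s i ↔ low s' i') → (s ≠ s' ∨ idx s i ≠ idx s' i') := by
        intro hll
        by_cases h : s = s'
        · subst h
          right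
          exact hinj s hs i i' hi hi' hll (by simpa using hne)
        · exact Or.inl h
      simp only [C]
      have t := wtop s _ hj
      have t' := wtop s' _ hj'
      by_cases h : low s i <;> by_cases h' : low s' i'
      · rw [if_pos h, if_pos h']
        exact p0 s _ s' _ ⟨hs, hlow s i h⟩ ⟨hs', hlow s' i' h'⟩ hj hj' (hne' (by tauto)) hint
      · rw [if_pos h, if_neg h']
        have := w0 s ⟨hs, hlow s i h⟩ _ hj
        have := w1 s' ⟨hs', hhigh s' i' h'⟩ _ hj'
        omega
      · rw [if_neg h, if_pos h']
        have := w1 s ⟨hs, hhigh s i h⟩ _ hj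
        have := w0 s' ⟨hs', hlow s' i' h'⟩ _ hj'
        omega
      · rw [if_neg h, if_neg h']
        have := p1 s _ s' _ ⟨hs, hhigh s i h⟩ ⟨hs', hhigh s' i' h'⟩ hj hj'
          (hne' (by tauto)) hint
        omega
    · intro s hs i hi
      have hj := hidx s hs i hi
      have t := wtop s _ hj
      have h1 := hk s hs
      by_cases hks : k s = K + 1
      · have hi0 : i = 0 := by simpa [hks] using hi
        have hpow : 2 ^ k s = 2 ^ K * 2 := by rw [hks, pow_succ]
        subst hi0
        simp only [C]
        split_ifs with h
        · have := w0 s ⟨hs, hlow s 0 h⟩ _ hj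
          omega
        · have := w1 s ⟨hs, hhigh s 0 h⟩ _ hj
          omega
      · have h2 : k' s = k s := by simp only [k']; omega
        have hK : 2 ^ K = 2 ^ (K - k s) * 2 ^ k s := by
          rw [← pow_add]; congr 1; omega
        simp only [C]
        split_ifs with h
        · have := w0 s ⟨hs, hlow s i h⟩ _ hj
          simp only [low, hks, if_false] at h
          simp only [idx, h, if_true, h2] at this ⊢
          exact this
        · have := w1 s ⟨hs, hhigh s i h⟩ _ hj
          simp only [low, hks, if_false] at h
          simp only [idx, h, if_false, h2] at this ⊢
          obtain ⟨d, rfl⟩ := Nat.exists_eq_add_of_le (not_lt.1 h)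
          rw [Nat.add_sub_cancel_left] at this ⊢
          rw [hK]
          constructor <;> nlinarith [this.1, this.2]

theorem stmt8 (S : Type) [Fintype S] (kstar : ℕ) (a b k : S → ℕ)
    (hab : ∀ s, 1 ≤ a s ∧ a s < b s) (hk : ∀ s, k s ≤ kstar)
    (hproper : ∃ C : S → ℕ → ℕ,
      (∀ s i s' i', i < 2 ^ (kstar - k s) → i' < 2 ^ (kstar - k s') → (s ≠ s' ∨ i ≠ i') →
        (Finset.Icc (a s) (b s - 1) ∩ Finset.Icc (a s') (b s' - 1)).Nonempty →
        C s i ≠ C s' i')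
      ∧ ∀ s i, i < 2 ^ (kstar - k s) → 1 ≤ C s i ∧ C s i ≤ 2 ^ kstar) :
    ∃ C : S → ℕ → ℕ, GoodOn a b k kstar (fun _ => True) C := by
  classical
  obtain ⟨C, hC, hr⟩ := hproper
  have hload : ∀ l : ℕ, ∑ s ∈ (Finset.univ : Finset S),
      (if a s ≤ l ∧ l < b s then 2 ^ (kstar - k s) else 0) ≤ 2 ^ kstar := by
    intro l
    rw [← Finset.sum_filter]
    let U : Finset (Σ _ : S, ℕ) := (Finset.univ.filter (fun s => a s ≤ l ∧ l < b s)).sigma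
      (fun s => Finset.range (2 ^ (kstar - k s)))
    have hU : U.card = ∑ s ∈ Finset.univ.filter (fun s => a s ≤ l ∧ l < b s),
        2 ^ (kstar - k s) := by
      simp [U, Finset.card_sigma]
    rw [← hU]
    have : U.card ≤ (Finset.Icc 1 (2 ^ kstar)).card := by
      refine Finset.card_le_card_of_injOn (fun p => C p.1 p.2) ?_ ?_
      · rintro ⟨s, i⟩ hp
        rw [Finset.mem_coe] at hp
        simp only [U, Finset.mem_sigma, Finset.mem_filter, Finset.mem_univ,
          true_and, Finset.mem_range] at hp
        simp only [Finset.coe_Icc, Set.mem_Icc]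
        exact hr s i hp.2
      · rintro ⟨s, i⟩ hp ⟨s', i'⟩ hp' heq
        rw [Finset.mem_coe] at hp hp'
        simp only [U, Finset.mem_sigma, Finset.mem_filter, Finset.mem_univ,
          true_and, Finset.mem_range] at hp hp'
        by_contra hne
        refine hC s i s' i' hp.2 hp'.2 ?_ ⟨l, ?_⟩ heq
        · by_contra hcon
          push Not at hcon
          obtain ⟨rfl, rfl⟩ := hcon
          exact hne rfl
        · simp only [Finset.mem_inter, Finset.mem_Icc]
          omega
    simpa using this
  obtain ⟨D, h1, h2⟩ := good_main a b hab kstar Finset.univ k (fun s _ => hk s) hload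
  exact ⟨D, fun s i s' i' _ _ => h1 s i s' i' (Finset.mem_univ _) (Finset.mem_univ _),
    fun s _ => h2 s (Finset.mem_univ _)⟩
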